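/- For every axiom A of DTB and every index variable α, the relativization A^{≺α} of A to the cone of indices below α is provable in DTB. -/

import Mathlib

/- # The theories ITB and DTB of iterated truth biconditionals (Enayat–Pakhomov, §3)

`ITB` is a two-sorted first-order theory with a number sort and a sort for indices of
truth definitions.  We render two-sorted logic (with possibly empty index sort) in the
usual single-sorted way: the language `LI` has the arithmetical symbols, a unary sort
predicate `Idx` picking out the indices, the order `≺` on indices, and the indexed truth
predicate `T_α(x)` (written `tr α x`).  Quantification over numbers/indices is
relativized quantification to `¬Idx`/`Idx`.  The axioms of `ITB` are: Robinson's `Q`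
relativized to the number sort (together with closure of the number sort under the
arithmetical operations), the statement that `≺` is a strict partial order on indices,
and the biconditionals `B_φ := ∀α (T_α(⌜φ⌝) ↔ φ^{≺α})` for every `LI`-sentence `φ`,
where `φ^{≺α}` relativizes all index quantifiers of `φ` to the cone `{β : β ≺ α}`.
Provability is rendered as semantic consequence `⊨ᵇ`, which matches first-order
provability by the Gödel completeness theorem. -/

open FirstOrder Language

namespace TDI

/-- Function symbols of arithmetic: `0`, `S`, `+`, `·`. -/
inductive ArithFunc : ℕ → Type
  | zero : ArithFunc 0
  | succ : ArithFunc 1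
  | add : ArithFunc 2
  | mul : ArithFunc 2

/-- Relation symbols of the language of `ITB`: the sort predicate `Idx`, the order `<`
on numbers, the order `≺` on indices, and the indexed truth predicate `T_α(x)`. -/
inductive ITBRel : ℕ → Type
  | idx : ITBRel 1
  | lt : ITBRel 2
  | prec : ITBRel 2
  | tr : ITBRel 2

/-- The language of `ITB`. -/
def LI : Language := ⟨ArithFunc, ITBRel⟩

/-- Access to the arithmetical symbols of a language extending `LA`. -/
class ArithSymbols (L : Language) where
  zs : L.Constants
  ss : L.Functions 1
  as : L.Functions 2
  ms : L.Functions 2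
  lts : L.Relations 2

instance : ArithSymbols LI :=
  ⟨ArithFunc.zero, ArithFunc.succ, ArithFunc.add, ArithFunc.mul, ITBRel.lt⟩

section Builders

variable {L : Language} [ArithSymbols L] {α : Type} {n : ℕ}

/-- The term `0`. -/
def tzero : L.Term α := Constants.term ArithSymbols.zs

/-- The term `S t`. -/
def tsucc (t : L.Term α) : L.Term α := Functions.apply₁ ArithSymbols.ss t

/-- The term `t + u`. -/
def tadd (t u : L.Term α) : L.Term α := Functions.apply₂ ArithSymbols.as t u

/-- The term `t · u`. -/
def tmul (t u : L.Term α) : L.Term α := Functions.apply₂ ArithSymbols.ms t u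

/-- The numeral of a natural number. -/
def tnum : ℕ → L.Term α
  | 0 => tzero
  | n + 1 => tsucc (tnum n)

/-- The atomic formula `t < u`. -/
def ltf (t u : L.Term (α ⊕ Fin n)) : L.BoundedFormula α n :=
  Relations.boundedFormula₂ ArithSymbols.lts t u

/-- The axioms of Robinson's arithmetic `Q` (in a language with `<`). -/
def QAxioms : L.Theory :=
  { ∀' ∼(tsucc &0 =' tzero),
    ∀' ∀' (tsucc &0 =' tsucc &1 ⟹ &0 =' &1),
    ∀' (∼(&0 =' tzero) ⟹ ∃' (&0 =' tsucc &1)),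
    ∀' (tadd &0 tzero =' &0),
    ∀' ∀' (tadd &0 (tsucc &1) =' tsucc (tadd &0 &1)),
    ∀' (tmul &0 tzero =' tzero),
    ∀' ∀' (tmul &0 (tsucc &1) =' tadd (tmul &0 &1) &0),
    ∀' ∀' (ltf &0 &1 ⇔ ∃' (tadd &2 (tsucc &0) =' &1)) }

end Builders

/-- `Idx t`: `t` is an index of a truth definition. -/
def idxF {α : Type} {n : ℕ} (t : LI.Term (α ⊕ Fin n)) : LI.BoundedFormula α n :=
  Relations.boundedFormula₁ ITBRel.idx t

/-- `t ≺ u`. -/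
def precF {α : Type} {n : ℕ} (t u : LI.Term (α ⊕ Fin n)) : LI.BoundedFormula α n :=
  Relations.boundedFormula₂ ITBRel.prec t u

/-- `T_t(u)`: the truth predicate with index `t` holds of `u`. -/
def trF {α : Type} {n : ℕ} (t u : LI.Term (α ⊕ Fin n)) : LI.BoundedFormula α n :=
  Relations.boundedFormula₂ ITBRel.tr t u

/-- Relativization of every quantifier by the guard `g`: each `∀ x φ` becomes
`∀ x (g → φ)` (and hence each `∃ x φ` becomes `∃ x (g ∧ φ)`, as `∃` is `¬∀¬`). -/
def relativize {L : Language} {α : Type} (g : ∀ n : ℕ, L.BoundedFormula α (n + 1)) :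
    ∀ {n : ℕ}, L.BoundedFormula α n → L.BoundedFormula α n
  | _, BoundedFormula.falsum => BoundedFormula.falsum
  | _, BoundedFormula.equal t u => BoundedFormula.equal t u
  | _, BoundedFormula.rel R ts => BoundedFormula.rel R ts
  | _, BoundedFormula.imp φ ψ => BoundedFormula.imp (relativize g φ) (relativize g ψ)
  | n, BoundedFormula.all φ => BoundedFormula.all ((g n).imp (relativize g φ))

/-- The guard for number-sort quantification: the quantified variable is not an index. -/
def numGuard (n : ℕ) : LI.BoundedFormula Empty (n + 1) :=
  ∼(idxF (Term.var (Sum.inr (Fin.last n))))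

/-- Relativization of a sentence to the number sort. -/
def relNum (σ : LI.Sentence) : LI.Sentence := relativize numGuard σ

/-- The guard for relativization to the cone below the index `α` (the free variable):
index quantifiers are restricted to `{β : β ≺ α}`, number quantifiers are unaffected. -/
def coneGuard (n : ℕ) : LI.BoundedFormula (Fin 1) (n + 1) :=
  idxF (Term.var (Sum.inr (Fin.last n))) ⟹
    precF (Term.var (Sum.inr (Fin.last n))) (Term.var (Sum.inl 0))

/-- `φ^{≺α}`: the relativization of the sentence `φ` to the cone of indices below the
free variable `α`. -/
def coneRel (σ : LI.Sentence) : LI.Formula (Fin 1) :=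
  relativize coneGuard (Formula.relabel (fun x : Empty => x.elim) σ)

instance : Countable (Σ n, LI.Functions n) := by
  refine (Function.Injective.countable (f := fun x : Σ n, LI.Functions n => match x with
    | ⟨_, .zero⟩ => (0 : ℕ) | ⟨_, .succ⟩ => 1 | ⟨_, .add⟩ => 2 | ⟨_, .mul⟩ => 3) ?_)
  rintro ⟨n, f⟩ ⟨m, g⟩ h
  cases f <;> cases g <;> simp_all

instance : Countable (Σ n, LI.Relations n) := by
  refine (Function.Injective.countable (f := fun x : Σ n, LI.Relations n => match x with
    | ⟨_, .idx⟩ => (0 : ℕ) | ⟨_, .lt⟩ => 1 | ⟨_, .prec⟩ => 2 | ⟨_, .tr⟩ => 3) ?_)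
  rintro ⟨n, f⟩ ⟨m, g⟩ h
  cases f <;> cases g <;> simp_all

instance (α : Type) [Countable α] : Countable (Σ n, LI.BoundedFormula α n) :=
  Function.Injective.countable (BoundedFormula.listEncode_sigma_injective)

instance (α : Type) (n : ℕ) [Countable α] : Countable (LI.BoundedFormula α n) :=
  Function.Injective.countable (f := fun φ => (⟨n, φ⟩ : Σ n, LI.BoundedFormula α n))
    (fun _ _ h => by simpa using h)

/-- A fixed Gödel numbering of a countable collection of syntactic objects. -/
noncomputable def gnum {β : Type} [Countable β] : β → ℕ :=
  (Encodable.ofCountable β).encode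

/-- A formula with one free variable, viewed in a context with one bound variable. -/
def oneVarClose (φ : LI.Formula (Fin 1)) : LI.BoundedFormula Empty (1 + 0) :=
  BoundedFormula.relabel (fun _ : Fin 1 => (Sum.inr 0 : Empty ⊕ Fin 1)) φ

/-- The biconditional `B_φ := ∀α (T_α(⌜φ⌝) ↔ φ^{≺α})`. -/
noncomputable def Bicond (φ : LI.Sentence) : LI.Sentence :=
  BoundedFormula.all
    ((idxF &0) ⟹ ((trF &0 (tnum (gnum φ))) ⇔ oneVarClose (coneRel φ)))

/-- The theory `ITB` of iterated truth biconditionals. -/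
def ITBtheory : LI.Theory :=
  (relNum '' QAxioms) ∪
    { ∼(idxF (tzero : LI.Term (Empty ⊕ Fin 0))),
      ∀' (∼(idxF &0) ⟹ ∼(idxF (tsucc &0))),
      ∀' ∀' ((∼(idxF &0) ⊓ ∼(idxF &1)) ⟹ ∼(idxF (tadd &0 &1))),
      ∀' ∀' ((∼(idxF &0) ⊓ ∼(idxF &1)) ⟹ ∼(idxF (tmul &0 &1))),
      ∀' ∀' (precF &0 &1 ⟹ (idxF &0 ⊓ idxF &1)),
      ∀' (idxF &0 ⟹ ∼(precF &0 &0)),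
      ∀' ∀' ∀' ((precF &0 &1 ⊓ precF &1 &2) ⟹ precF &0 &2) } ∪
    Set.range Bicond

/-- The sentence asserting that there exists an index. -/
def ExistsIdx : LI.Sentence := ∃' (idxF &0)

/-- The sentence asserting that below every index there is another index. -/
def DescendAx : LI.Sentence := ∀' (idxF &0 ⟹ ∃' (idxF &1 ⊓ precF &1 &0))

/-- `DTB := ITB + ∀α ∃β (β ≺ α) + ∃α (α = α)`. -/
def DTB : LI.Theory := ITBtheory ∪ {DescendAx, ExistsIdx}

/-- The sentence asserting the existence of a `≺`-minimal index. -/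
def MinSent : LI.Sentence := ∃' (idxF &0 ⊓ ∀' (idxF &1 ⟹ ∼(precF &1 &0)))

/-- `θ(⌜φ⌝)` for a Gödel number `k`: the sentence `∀α T_α(k̲)`. -/
noncomputable def thetaAt (k : ℕ) : LI.Sentence := ∀' (idxF &0 ⟹ trF &0 (tnum k))

end TDI

namespace TDI

section RealizeIn

variable {L : Language} {M : Type*} [L.Structure M] {α β : Type}

/-- Truth of a formula in `M` with all quantifiers restricted to the domain `D`, which need not be
closed under the function symbols. -/
def RealizeIn (D : M → Prop) :
    ∀ {n : ℕ}, L.BoundedFormula α n → (α → M) → (Fin n → M) → Prop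
  | _, BoundedFormula.falsum, _, _ => False
  | _, BoundedFormula.equal t u, v, xs => t.realize (Sum.elim v xs) = u.realize (Sum.elim v xs)
  | _, BoundedFormula.rel R ts, v, xs =>
    Structure.RelMap R fun i => (ts i).realize (Sum.elim v xs)
  | _, BoundedFormula.imp φ ψ, v, xs => RealizeIn D φ v xs → RealizeIn D ψ v xs
  | _, BoundedFormula.all φ, v, xs => ∀ x, D x → RealizeIn D φ v (Fin.snoc xs x)

theorem realizeIn_not {D : M → Prop} {n : ℕ} {φ : L.BoundedFormula α n} {v : α → M}
    {xs : Fin n → M} : RealizeIn D (∼φ) v xs ↔ ¬ RealizeIn D φ v xs :=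
  Iff.rfl

theorem realizeIn_imp {D : M → Prop} {n : ℕ} {φ ψ : L.BoundedFormula α n} {v : α → M}
    {xs : Fin n → M} :
    RealizeIn D (φ ⟹ ψ) v xs ↔ (RealizeIn D φ v xs → RealizeIn D ψ v xs) :=
  Iff.rfl

theorem realizeIn_all {D : M → Prop} {n : ℕ} {φ : L.BoundedFormula α (n + 1)} {v : α → M}
    {xs : Fin n → M} :
    RealizeIn D (∀' φ) v xs ↔ ∀ x, D x → RealizeIn D φ v (Fin.snoc xs x) :=
  Iff.rfl

theorem realizeIn_inf {D : M → Prop} {n : ℕ} {φ ψ : L.BoundedFormula α n} {v : α → M}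
    {xs : Fin n → M} :
    RealizeIn D (φ ⊓ ψ) v xs ↔ RealizeIn D φ v xs ∧ RealizeIn D ψ v xs := by
  change ((RealizeIn D φ v xs → (RealizeIn D ψ v xs → False)) → False) ↔ _
  tauto

theorem realizeIn_iff {D : M → Prop} {n : ℕ} {φ ψ : L.BoundedFormula α n} {v : α → M}
    {xs : Fin n → M} :
    RealizeIn D (φ ⇔ ψ) v xs ↔ (RealizeIn D φ v xs ↔ RealizeIn D ψ v xs) := by
  rw [BoundedFormula.iff, realizeIn_inf, realizeIn_imp, realizeIn_imp]
  exact iff_def.symm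

theorem realizeIn_ex {D : M → Prop} {n : ℕ} {φ : L.BoundedFormula α (n + 1)} {v : α → M}
    {xs : Fin n → M} :
    RealizeIn D (∃' φ) v xs ↔ ∃ x, D x ∧ RealizeIn D φ v (Fin.snoc xs x) := by
  rw [BoundedFormula.ex, realizeIn_not, realizeIn_all]
  simp only [realizeIn_not]
  push Not
  rfl

theorem realizeIn_true {n : ℕ} (φ : L.BoundedFormula α n) (v : α → M) (xs : Fin n → M) :
    RealizeIn (fun _ => True) φ v xs ↔ φ.Realize v xs := by
  induction φ with
  | falsum => rfl
  | equal => rfl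
  | rel => rfl
  | imp _ _ ih₁ ih₂ => exact imp_congr (ih₁ xs) (ih₂ xs)
  | all _ ih => exact forall_congr' fun x => (true_imp_iff).trans (ih _)

theorem realizeIn_relativize {D E : M → Prop} {g : ∀ n : ℕ, L.BoundedFormula α (n + 1)}
    {v : α → M}
    (hg : ∀ (n : ℕ) (xs : Fin (n + 1) → M),
      RealizeIn D (g n) v xs ↔ E (xs (Fin.last n)))
    {n : ℕ} (φ : L.BoundedFormula α n) (xs : Fin n → M) :
    RealizeIn D (relativize g φ) v xs ↔ RealizeIn (fun x => D x ∧ E x) φ v xs := by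
  induction φ with
  | falsum => rfl
  | equal => rfl
  | rel => rfl
  | imp _ _ ih₁ ih₂ => exact imp_congr (ih₁ xs) (ih₂ xs)
  | all _ ih =>
    refine forall_congr' fun x => ?_
    rw [and_imp]
    refine imp_congr_right fun _ => imp_congr ?_ (ih _)
    rw [hg, Fin.snoc_last]

theorem realizeIn_relabel {D : M → Prop} {m n : ℕ} {φ : L.BoundedFormula α n}
    {g : α → β ⊕ (Fin m)} {v : β → M} {xs : Fin (m + n) → M} :
    RealizeIn D (φ.relabel g) v xs ↔
      RealizeIn D φ (Sum.elim v (xs ∘ Fin.castAdd n) ∘ g) (xs ∘ Fin.natAdd m) := by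
  have term_eq : ∀ {k : ℕ} (t : L.Term (α ⊕ Fin k)) (ys : Fin (m + k) → M),
      (t.relabel (BoundedFormula.relabelAux g k)).realize (Sum.elim v ys) =
        t.realize (Sum.elim (Sum.elim v (ys ∘ Fin.castAdd k) ∘ g) (ys ∘ Fin.natAdd m)) := by
    intro k t ys
    rw [Term.realize_relabel, BoundedFormula.sumElim_comp_relabelAux]
  induction φ with
  | falsum => rfl
  | equal t u =>
    change (t.relabel _).realize _ = (u.relabel _).realize _ ↔ _
    rw [term_eq, term_eq]
    rfl
  | rel R ts =>
    change Structure.RelMap R (fun i => ((ts i).relabel _).realize _) ↔ _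
    simp only [term_eq]
    rfl
  | imp _ _ ih₁ ih₂ => exact imp_congr ih₁ ih₂
  | @all k φ ih =>
    rw [BoundedFormula.relabel_all, realizeIn_all, realizeIn_all]
    refine forall_congr' fun x => imp_congr_right fun _ => ?_
    refine ih.trans ?_
    rw [Fin.snoc_comp_natAdd]
    have hcast : (Fin.snoc xs x : Fin (m + k + 1) → M) ∘ Fin.castAdd (k + 1) =
        xs ∘ Fin.castAdd k := by
      funext i
      exact Fin.snoc_castSucc (α := fun _ => M) x xs (Fin.castAdd k i)
    rw [← hcast]

end RealizeIn

section Cone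

variable {M : Type*} [LI.Structure M]

/-- `x` is an index in the structure. -/
def IsIdx (x : M) : Prop := Structure.RelMap (L := LI) ITBRel.idx ![x]

/-- The order of indices in the structure. -/
def IsPrec (x y : M) : Prop := Structure.RelMap (L := LI) ITBRel.prec ![x, y]

/-- The numbers together with the indices below `a`. -/
def Cone (a x : M) : Prop := IsIdx x → IsPrec x a

theorem realizeIn_idxF {D : M → Prop} {α : Type} {n : ℕ} {t : LI.Term (α ⊕ Fin n)}
    {v : α → M} {xs : Fin n → M} :
    RealizeIn D (idxF t) v xs ↔ IsIdx (t.realize (Sum.elim v xs)) :=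
  BoundedFormula.realize_rel₁ (L := LI) (R := (ITBRel.idx : LI.Relations 1)) (t := t) (v := v)
    (xs := xs)

theorem realizeIn_precF {D : M → Prop} {α : Type} {n : ℕ} {t u : LI.Term (α ⊕ Fin n)}
    {v : α → M} {xs : Fin n → M} :
    RealizeIn D (precF t u) v xs ↔
      IsPrec (t.realize (Sum.elim v xs)) (u.realize (Sum.elim v xs)) :=
  BoundedFormula.realize_rel₂ (L := LI) (R := (ITBRel.prec : LI.Relations 2)) (t₁ := t) (t₂ := u)
    (v := v) (xs := xs)

theorem realizeIn_relNum {D : M → Prop} {σ : LI.Sentence} {v : Empty → M} {xs : Fin 0 → M} :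
    RealizeIn D (relNum σ) v xs ↔ RealizeIn (fun x => D x ∧ ¬ IsIdx x) σ v xs :=
  realizeIn_relativize (g := numGuard) (E := fun x => ¬ IsIdx x)
    (fun _ _ => not_congr realizeIn_idxF) σ xs

theorem realizeIn_coneRel {D : M → Prop} {σ : LI.Sentence} {v : Fin 1 → M} {xs : Fin 0 → M} :
    RealizeIn D (coneRel σ) v xs ↔
      RealizeIn (fun x => D x ∧ Cone (v 0) x) σ default default := by
  refine (realizeIn_relativize (g := coneGuard) (E := Cone (v 0))
    (fun _ _ => imp_congr realizeIn_idxF realizeIn_precF) _ xs).trans ?_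
  refine (realizeIn_relabel (m := 0) (n := 0) (xs := xs)).trans ?_
  rw [Subsingleton.elim (_ ∘ _ : Empty → M) default,
    Subsingleton.elim (xs ∘ _ : Fin 0 → M) default]

theorem realizeIn_oneVarClose_coneRel {D : M → Prop} {σ : LI.Sentence} {v : Empty → M}
    {xs : Fin 1 → M} :
    RealizeIn D (oneVarClose (coneRel σ)) v xs ↔
      RealizeIn (fun x => D x ∧ Cone (xs 0) x) σ default default :=
  (realizeIn_relabel (m := 1) (n := 0) (xs := xs)).trans realizeIn_coneRel

theorem realizeIn_cone_of_mem_DTB [M ⊨ DTB] {a : M} (ha : IsIdx a) {A : LI.Sentence}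
    (hA : A ∈ DTB) : RealizeIn (Cone a) A (default : Empty → M) default := by
  have models : ∀ σ ∈ DTB, RealizeIn (fun _ : M => True) σ default default := fun σ hσ =>
    (realizeIn_true _ _ _).2 (Theory.realize_sentence_of_mem DTB hσ)
  have trans : ∀ x y z : M, IsPrec x y → IsPrec y z → IsPrec x z := by
    have h := models (∀' ∀' ∀' ((precF &0 &1 ⊓ precF &1 &2) ⟹ precF &0 &2))
      (by simp [DTB, ITBtheory])
    intro x y z hxy hyz
    have h := h x trivial y trivial z trivial
    rw [realizeIn_imp, realizeIn_inf, realizeIn_precF, realizeIn_precF, realizeIn_precF] at h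
    exact h ⟨hxy, hyz⟩
  have descend : ∀ x : M, IsIdx x → ∃ y : M, IsIdx y ∧ IsPrec y x := by
    have h := models DescendAx (by simp [DTB])
    intro x hx
    obtain ⟨y, -, hy⟩ := realizeIn_ex.1 (h x trivial (realizeIn_idxF.2 hx))
    rw [realizeIn_inf, realizeIn_idxF, realizeIn_precF] at hy
    exact ⟨y, hy⟩
  have hM := models A hA
  rcases hA with ((⟨σ, -, rfl⟩ | hA) | ⟨φ, rfl⟩) | hA
  · rw [realizeIn_relNum] at hM ⊢
    convert hM using 2
    exact and_congr_left fun hx => iff_of_true (fun hxi => absurd hxi hx) trivial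
  · simp only [Set.mem_insert_iff, Set.mem_singleton_iff] at hA
    rcases hA with rfl | rfl | rfl | rfl | rfl | rfl | rfl
    · exact hM
    · exact fun x _ => hM x trivial
    · exact fun x _ y _ => hM x trivial y trivial
    · exact fun x _ y _ => hM x trivial y trivial
    · exact fun x _ y _ => hM x trivial y trivial
    · exact fun x _ => hM x trivial
    · exact fun x _ y _ z _ => hM x trivial y trivial z trivial
  · intro b hb hbi
    have h := realizeIn_iff.1 (hM b trivial hbi)
    have hba : IsPrec b a := hb (realizeIn_idxF.1 hbi)
    refine realizeIn_iff.2 (h.trans ?_)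
    refine realizeIn_oneVarClose_coneRel.trans
      (Iff.trans (iff_of_eq ?_) realizeIn_oneVarClose_coneRel.symm)
    congr 1
    funext x
    exact propext (and_congr_left fun hx =>
      iff_of_true trivial fun hxi => trans x b a (hx hxi) hba)
  · rcases hA with rfl | rfl
    · intro b hb hbi
      have hbi := realizeIn_idxF.1 hbi
      obtain ⟨c, hc, hcb⟩ := descend b hbi
      refine realizeIn_ex.2 ⟨c, fun _ => trans c b a hcb (hb hbi), realizeIn_inf.2 ?_⟩
      exact ⟨realizeIn_idxF.2 hc, realizeIn_precF.2 hcb⟩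
    · obtain ⟨c, hc, hca⟩ := descend a ha
      exact realizeIn_ex.2 ⟨c, fun _ => hca, realizeIn_idxF.2 hc⟩

end Cone

end TDI

/-- For every axiom `A` of `DTB` (and every index variable `α`), the relativization
`A^{≺α}` of `A` to the cone of indices below `α` is provable in `DTB`; we state its
universal closure `∀α (Idx(α) → A^{≺α})`. -/
theorem stmt_8 :
    ∀ A ∈ TDI.DTB,
      TDI.DTB ⊨ᵇ (BoundedFormula.all
        ((TDI.idxF &0) ⟹ TDI.oneVarClose (TDI.coneRel A))) := by
  intro A hA M v xs
  refine (TDI.realizeIn_true _ _ _).1 fun a _ ha => ?_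
  have h := TDI.realizeIn_cone_of_mem_DTB (TDI.realizeIn_idxF.1 ha) hA
  refine TDI.realizeIn_oneVarClose_coneRel.2 ?_
  simp only [true_and]
  exact h
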